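/- arXiv:2411.18661 — 2 statements merged into one kernel-verified Lean document; each statement's English description precedes it below -/
import Mathlib

section
/- Let R be a complete Noetherian local integral domain with maximal ideal m_R, let G be a group, and let T be a 2-dimensional pseudo-representation of G over R with respect to c ∈ G, with associated functions a, d, y. Assume y(σ, τ) ∈ m_R for all σ, τ ∈ G. Let α, α′ ∈ G and, for γ ∈ {α, α′}, let I_γ be the ideal of R generated by {y(γ, β) : β ∈ G}; assume that every prime ideal of R minimal among primes containing I_α has height at least 2, and likewise for I_{α′}. Then there exists an element u of the integral closure B of R in Frac(R) which is a unit of B and satisfies u · y(α′, β) = y(α, β) in Frac(R) for all β ∈ G. -/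
universe u

/-- If a trace-like linear form satisfies the 2-dimensional pseudo-representation identity, then
an idempotent of trace one has rank one. -/
lemma pseudotrace_mul_of_idempotent {R S : Type*} [CommRing R] [Ring S] [Algebra R S]
    (L : S →ₗ[R] R) (hcomm : ∀ x z, L (x * z) = L (z * x))
    (hrel : ∀ x z w, L (x * z * w) + L (x * w * z) - L (x * w) * L z - L (w * z) * L x
      - L (z * x) * L w + L x * L z * L w = 0)
    {e : S} (he : e * e = e) (hLe : L e = 1) (s t : S) :
    L (e * s * e * t) = L (e * s) * L (e * t) := by
  have h := hrel e (e * s * e) (e * t * e)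
  have h1 (z : S) : L (e * z * e) = L (e * z) := by
    rw [hcomm, ← mul_assoc, he]
  have h2 : e * (e * s * e) * (e * t * e) = e * (s * e * t) * e := by
    rw [show e * (e * s * e) * (e * t * e) = (e * e) * s * (e * e) * t * e by
      simp only [mul_assoc], he]
    simp only [mul_assoc]
  have h3 : e * (e * t * e) * (e * s * e) = e * (t * e * s) * e := by
    rw [show e * (e * t * e) * (e * s * e) = (e * e) * t * (e * e) * s * e by
      simp only [mul_assoc], he]
    simp only [mul_assoc]
  have h4 : e * (e * t * e) = e * t * e := by simp only [← mul_assoc, he]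
  have h5 : e * t * e * (e * s * e) = e * (t * e * s) * e := by
    rw [show e * t * e * (e * s * e) = e * t * (e * e) * s * e by simp only [mul_assoc], he]
    simp only [mul_assoc]
  have h6 : e * s * e * e = e * s * e := by rw [mul_assoc _ e e, he]
  have h7 : L (e * (t * e * s)) = L (e * (s * e * t)) := by
    rw [show e * (t * e * s) = (e * t) * (e * s) by simp only [mul_assoc], hcomm]
    simp only [mul_assoc]
  rw [h2, h3, h4, h5, h6, h1, h1, h1, h1, hLe, h7] at h
  have h8 : e * s * e * t = e * (s * e * t) := by simp only [mul_assoc]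
  rw [h8]
  linear_combination h

/-- The functions `y` attached to a 2-dimensional pseudo-representation have rank one. -/
lemma pseudorep_y_mul_y {R : Type*} [CommRing R] [Invertible (2 : R)] {G : Type*} [Group G]
    (T : G → R) (c : G)
    (hc : c ^ 2 = 1) (hT1 : T 1 = 2) (hTc : T c = 0)
    (hcomm : ∀ σ τ : G, T (σ * τ) = T (τ * σ))
    (hrel : ∀ γ δ η : G,
      T (γ * δ * η) + T (γ * η * δ) - T (γ * η) * T δ - T (η * δ) * T γ
        - T (δ * γ) * T η + T γ * T δ * T η = 0)
    (a : G → R) (y : G → G → R)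
    (ha : ∀ σ : G, 2 * a σ = T (c * σ) + T σ)
    (hy : ∀ σ τ : G, y σ τ = a (σ * τ) - a σ * a τ) (σ σ' τ τ' : G) :
    y σ τ * y σ' τ' = y σ' τ * y σ τ' := by
  let S := MonoidAlgebra R G
  let o : G →* S := MonoidAlgebra.of R G
  let L : S →ₗ[R] R := Finsupp.linearCombination R T ∘ₗ
    (MonoidAlgebra.coeffLinearEquiv R).toLinearMap
  have hLo (g : G) : L (o g) = T g := by
    change Finsupp.linearCombination R T (Finsupp.single g 1) = T g
    simp
  have hmul (g h : G) : o g * o h = o (g * h) := (map_mul o g h).symm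
  have hLcomm (x z : S) : L (x * z) = L (z * x) := by
    induction x using MonoidAlgebra.induction_on with
    | add x x' hx hx' => simp only [add_mul, mul_add, map_add, hx, hx']
    | smul r x hx => simp only [smul_mul_assoc, mul_smul_comm, map_smul, hx]
    | of g =>
      induction z using MonoidAlgebra.induction_on with
      | add x x' hx hx' => simp only [add_mul, mul_add, map_add, hx, hx']
      | smul r x hx => simp only [smul_mul_assoc, mul_smul_comm, map_smul, hx]
      | of h => rw [hmul, hmul, hLo, hLo, hcomm]
  have hLrel (x z w : S) : L (x * z * w) + L (x * w * z) - L (x * w) * L z - L (w * z) * L x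
      - L (z * x) * L w + L x * L z * L w = 0 := by
    induction x using MonoidAlgebra.induction_on with
    | add x x' hx hx' => simp only [add_mul, mul_add, map_add]; linear_combination hx + hx'
    | smul r x hx =>
      simp only [smul_mul_assoc, mul_smul_comm, map_smul, smul_eq_mul]; linear_combination r * hx
    | of g =>
      induction z using MonoidAlgebra.induction_on with
      | add x x' hx hx' => simp only [add_mul, mul_add, map_add]; linear_combination hx + hx'
      | smul r x hx =>
        simp only [smul_mul_assoc, mul_smul_comm, map_smul, smul_eq_mul]; linear_combination r * hx
      | of h =>
        induction w using MonoidAlgebra.induction_on with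
        | add x x' hx hx' => simp only [add_mul, mul_add, map_add]; linear_combination hx + hx'
        | smul r x hx =>
          simp only [smul_mul_assoc, mul_smul_comm, map_smul, smul_eq_mul]
          linear_combination r * hx
        | of k =>
          change L (o g * o h * o k) + L (o g * o k * o h) - L (o g * o k) * L (o h)
            - L (o k * o h) * L (o g) - L (o h * o g) * L (o k) + L (o g) * L (o h) * L (o k) = 0
          simp only [hmul, hLo]
          exact hrel g h k
  have hcc : o c * o c = 1 := by rw [hmul, ← sq, hc, map_one]
  have hL1 : L 1 = 2 := by rw [← map_one o, hLo, hT1]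
  have hhalf : (⅟2 : R) * 2 = 1 := invOf_mul_self 2
  let e : S := (⅟2 : R) • (1 + o c)
  let f : S := (⅟2 : R) • (1 - o c)
  have hef : e + f = 1 := by
    simp only [e, f, ← smul_add]
    rw [show (1 + o c + (1 - o c) : S) = (2 : R) • 1 by rw [two_smul]; abel, smul_smul, hhalf,
      one_smul]
  have hee : e * e = e := by
    simp only [e, smul_mul_smul_comm]
    rw [show (1 + o c) * (1 + o c) = (2 : R) • (1 + o c) by
      rw [two_smul, mul_add, add_mul, add_mul, hcc]; simp only [one_mul, mul_one]; abel,
      smul_smul, mul_assoc, hhalf, mul_one]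
  have hf : f = 1 - e := by rw [← hef]; abel
  have hff : f * f = f := by
    rw [hf, mul_sub, sub_mul, sub_mul, hee]; simp
  have hLe : L e = 1 := by
    simp only [e, map_smul, map_add, hL1, hLo, hTc, smul_eq_mul, add_zero, hhalf]
  have hLf : L f = 1 := by
    simp only [f, map_smul, map_sub, hL1, hLo, hTc, smul_eq_mul, sub_zero, hhalf]
  have hea (g : G) : L (e * o g) = a g := by
    simp only [e, smul_mul_assoc, add_mul, one_mul, hmul, map_smul, map_add, hLo, smul_eq_mul]
    linear_combination (-⅟2 : R) * ha g + a g * hhalf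
  have hya (g h : G) : L (e * o g * f * o h) = y g h := by
    rw [hf, mul_sub, sub_mul, mul_one, map_sub,
      pseudotrace_mul_of_idempotent L hLcomm hLrel hee hLe, hea, hea, mul_assoc, hmul, hea, hy]
  have hyf (g h : G) : L (f * o h * e * o g) = y g h := by
    rw [← hya, mul_assoc _ e, hLcomm, ← mul_assoc]
  have he' := pseudotrace_mul_of_idempotent L hLcomm hLrel hee hLe (o σ * f * o τ) (o σ' * f * o τ')
  have hf' := pseudotrace_mul_of_idempotent L hLcomm hLrel hff hLf (o τ * e * o σ') (o τ' * e * o σ)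
  have hrot : e * (o σ * f * o τ) * e * (o σ' * f * o τ') =
      (e * o σ) * (f * o τ * e * o σ' * f * o τ') := by simp only [mul_assoc]
  have hrot' : f * (o τ * e * o σ') * f * (o τ' * e * o σ) =
      (f * o τ * e * o σ' * f * o τ') * (e * o σ) := by simp only [mul_assoc]
  rw [hrot, hLcomm, ← hrot', hf'] at he'
  simp only [← mul_assoc] at he'
  rw [hyf, hyf, hya, hya] at he'
  exact he'.symm

lemma PrimeSpectrum.comap_strictMono_of_isIntegral {A B : Type*} [CommRing A] [CommRing B]
    [Algebra A B] [Algebra.IsIntegral A B] :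
    StrictMono (PrimeSpectrum.comap (algebraMap A B)) :=
  fun _ _ h ↦ Ideal.IsIntegral.comap_lt_comap h

/-- In a Noetherian integrally closed domain `A`, an element of the fraction field which is not in
`A` fails to be in the localization of `A` at some prime of height at most one. -/
lemma exists_prime_height_le_one_of_notMem_range {A L : Type*} [CommRing A] [IsDomain A]
    [IsNoetherianRing A] [IsIntegrallyClosed A] [Field L] [Algebra A L] [IsFractionRing A L]
    {c : L} (hc : c ∉ (algebraMap A L).range) :
    ∃ q : Ideal A, q.IsPrime ∧ q.height ≤ 1 ∧
      ∀ s ∉ q, algebraMap A L s * c ∉ (algebraMap A L).range := by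
  let N : Submodule A L := LinearMap.range (Algebra.linearMap A L)
  have hN (x : L) : x ∈ N ↔ x ∈ (algebraMap A L).range := Iff.rfl
  have hc0 : N.mkQ c ≠ 0 := by
    simpa [Submodule.Quotient.mk_eq_zero, hN] using hc
  obtain ⟨q, hq, hle⟩ := exists_le_isAssociatedPrime_of_isNoetherianRing A (N.mkQ c) hc0
  obtain ⟨hqp, z', hz'⟩ := (isAssociatedPrime_iff).1 hq
  obtain ⟨z, rfl⟩ := N.mkQ_surjective z'
  have hcolon (x : L) (s : A) : s ∈ (⊥ : Submodule A (L ⧸ N)).colon {N.mkQ x} ↔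
      algebraMap A L s * x ∈ (algebraMap A L).range := by
    rw [Submodule.mem_colon_singleton, ← map_smul, Submodule.mem_bot, Submodule.mkQ_apply,
      Submodule.Quotient.mk_eq_zero, hN, Algebra.smul_def]
  have hqz (s : A) : s ∈ q ↔ algebraMap A L s * z ∈ (algebraMap A L).range := by
    rw [hz', hcolon]
  refine ⟨q, hqp, ?_, fun s hs h ↦ hs (hle ((hcolon _ _).2 h))⟩
  have hinj := IsFractionRing.injective A L
  have hz : z ∉ (algebraMap A L).range := by
    have := (hqz 1).not.1 ((Ideal.ne_top_iff_one q).1 hqp.ne_top)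
    simpa using this
  by_cases hq0 : q = ⊥
  · simp [hq0]
  obtain ⟨x, hx, w, hw, hwq⟩ : ∃ x ∈ q, ∃ w : A, algebraMap A L w = algebraMap A L x * z ∧ w ∉ q := by
    by_contra! hcon
    apply hz
    refine IsIntegrallyClosed.isIntegral_iff.1
      (isIntegral_of_smul_mem_submodule (Submodule.map (Algebra.linearMap A L) q) ?_
        ((IsNoetherian.noetherian q).map _) z ?_)
    · rwa [Ne, ← Submodule.map_bot (Algebra.linearMap A L), (Submodule.map_injective_of_injective hinj).eq_iff]
    · rintro _ ⟨x, hx, rfl⟩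
      obtain ⟨w, hw⟩ := (hqz x).1 hx
      refine ⟨w, hcon x hx w hw, ?_⟩
      simp only [Algebra.linearMap_apply, hw, smul_eq_mul, mul_comm]
  refine Ideal.height_le_one_of_isPrincipal_of_mem_minimalPrimes (Ideal.span {x}) q ?_
  refine ⟨⟨hqp, by simpa [Ideal.span_le] using hx⟩, fun p ⟨hp, hxp⟩ hpq y hy ↦ ?_⟩
  obtain ⟨v, hv⟩ := (hqz y).1 hy
  have hyw : y * w = v * x := hinj (by rw [map_mul, map_mul, hv, hw]; ring)
  have : y * w ∈ p := hyw ▸ Ideal.mul_mem_left _ _ (hxp (Ideal.mem_span_singleton_self x))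
  exact (hp.mem_or_mem this).resolve_right fun h ↦ hwq (hpq h)

/-- Let `R` be integral over a Noetherian integrally closed domain. An element of the fraction
field of `R` which multiplies into `R` an ideal all of whose minimal primes have height at least
two is integral over `R`. -/
lemma isIntegral_of_mul_mem_range_of_two_le_height {A R K : Type*} [CommRing A] [IsDomain A]
    [IsNoetherianRing A] [IsIntegrallyClosed A] [CommRing R] [IsDomain R] [Algebra A R]
    [Algebra.IsIntegral A R] [FaithfulSMul A R] [Field K] [Algebra R K] [IsFractionRing R K]
    {u : K} {J : Ideal R} (hJ : ∀ P ∈ J.minimalPrimes, 2 ≤ P.height)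
    (hu : ∀ j ∈ J, algebraMap R K j * u ∈ (algebraMap R K).range) : IsIntegral R u := by
  let : Algebra A K := ((algebraMap R K).comp (algebraMap A R)).toAlgebra
  have : IsScalarTower A R K := IsScalarTower.of_algebraMap_eq fun _ ↦ rfl
  have : FaithfulSMul A K := (faithfulSMul_iff_algebraMap_injective A K).2
    ((IsFractionRing.injective R K).comp (FaithfulSMul.algebraMap_injective A R))
  let L := FractionRing A
  let : Algebra L K := FractionRing.liftAlgebra A K
  have : IsScalarTower A L K := FractionRing.isScalarTower_liftAlgebra A K
  have halg : Algebra.IsAlgebraic L K := by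
    have : Algebra.IsAlgebraic A R := Algebra.IsIntegral.isAlgebraic
    have : Algebra.IsAlgebraic R K := IsLocalization.isAlgebraic K (nonZeroDivisors R)
    exact (IsFractionRing.comap_isAlgebraic_iff (A := A)).1 (.trans A R K)
  have hint : IsIntegral L u := (halg.isAlgebraic u).isIntegral
  suffices IsIntegral A u from this.tower_top
  by_cases hcoeff : ∀ i, (minpoly L u).coeff i ∈ (algebraMap A L).range
  · obtain ⟨g, hg, -, hmon⟩ := Polynomial.lifts_and_natDegree_eq_and_monic
      ((Polynomial.lifts_iff_coeff_lifts _).2 hcoeff) (minpoly.monic hint)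
    refine ⟨g, hmon, ?_⟩
    rw [IsScalarTower.algebraMap_eq A L K, ← Polynomial.eval₂_map, hg]
    exact minpoly.aeval L u
  push Not at hcoeff
  obtain ⟨i, hi⟩ := hcoeff
  obtain ⟨q, hq, hq1, hqc⟩ := exists_prime_height_le_one_of_notMem_range hi
  exfalso
  obtain ⟨a, haq, haJ⟩ : ∃ a ∉ q, algebraMap A R a ∈ J := by
    by_contra! hcon
    obtain ⟨P, hP, hJP, hdisj⟩ := Ideal.exists_le_prime_disjoint J
      (q.primeCompl.map (algebraMap A R)) (by
        rw [Set.disjoint_left]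
        rintro _ hj ⟨a, ha, rfl⟩
        exact hcon a ha hj)
    have hPq : P.comap (algebraMap A R) ≤ q := fun a ha ↦ by
      by_contra haq
      exact Set.disjoint_left.1 hdisj ha ⟨a, haq, rfl⟩
    obtain ⟨P', hP', hP'P⟩ := Ideal.exists_minimalPrimes_le hJP
    have h2 : 2 ≤ P.height := (hJ P' hP').trans (Ideal.height_mono hP'P)
    have h3 : P.height ≤ (P.comap (algebraMap A R)).height := by
      have := Order.height_le_height_apply_of_strictMono _
        (PrimeSpectrum.comap_strictMono_of_isIntegral (A := A) (B := R)) ⟨P, hP⟩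
      rwa [← PrimeSpectrum.height_eq_orderHeight, ← PrimeSpectrum.height_eq_orderHeight] at this
    have := (h2.trans h3).trans ((Ideal.height_mono hPq).trans hq1)
    norm_num at this
  obtain ⟨r, hr⟩ := hu _ haJ
  have hru : algebraMap R K r = algebraMap A L a • u := by
    rw [hr, Algebra.smul_def, ← IsScalarTower.algebraMap_apply, ← IsScalarTower.algebraMap_apply]
  have hmin := minpoly.isIntegrallyClosed_eq_field_fractions L K
    (Algebra.IsIntegral.isIntegral (R := A) r)
  have ha0 : a ≠ 0 := fun h ↦ haq (h ▸ q.zero_mem)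
  rw [hru, IsIntegrallyClosed.minpoly_smul (by simpa using ha0) hint] at hmin
  have hci := congrArg (Polynomial.coeff · i) hmin
  simp only [Polynomial.coeff_scaleRoots, Polynomial.coeff_map] at hci
  refine hqc (a ^ ((minpoly L u).natDegree - i)) (fun h ↦ haq (hq.mem_of_pow_mem _ h)) ?_
  rw [map_pow, mul_comm, hci]
  exact ⟨_, rfl⟩

section

open scoped PowerSeries

namespace PowerSeries

lemma map_range_iff {A B : Type*} [CommRing A] [CommRing B] (φ : A →+* B) (g : B⟦X⟧) :
    g ∈ (map φ).range ↔ ∀ n, coeff n g ∈ φ.range := by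
  refine ⟨?_, fun h ↦ ?_⟩
  · rintro ⟨f, rfl⟩ n
    exact ⟨coeff n f, (coeff_map φ n f).symm⟩
  · choose a ha using h
    exact ⟨mk a, by ext n; rw [coeff_map, coeff_mk, ha]⟩

/-- If all powers of a power series `g` over `K` have a common denominator in `D⟦X⟧` and `D` is
Noetherian and integrally closed in its fraction field `K`, then `g` has coefficients in `D`. -/
lemma mem_range_map_of_isAlmostIntegral {D K : Type*} [CommRing D] [IsDomain D]
    [IsNoetherianRing D] [IsIntegrallyClosed D] [Field K] [Algebra D K] [IsFractionRing D K]
    [Algebra D⟦X⟧ K⟦X⟧] (halg : algebraMap D⟦X⟧ K⟦X⟧ = map (algebraMap D K)) {g : K⟦X⟧}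
    (hg : IsAlmostIntegral D⟦X⟧ g) : g ∈ (map (algebraMap D K)).range := by
  rw [map_range_iff]
  have h0 {g : K⟦X⟧} (hg : IsAlmostIntegral D⟦X⟧ g) : coeff 0 g ∈ (algebraMap D K).range := by
    obtain ⟨r, hr, hrg⟩ := hg
    have hr0 : r ≠ 0 := nonZeroDivisors.ne_zero hr
    refine IsIntegrallyClosed.isIntegral_iff.1
      (IsAlmostIntegral.isIntegral ⟨coeff r.order.toNat r,
        mem_nonZeroDivisors_of_ne_zero (coeff_order hr0), fun n ↦ ?_⟩)
    obtain ⟨s, hs⟩ := hrg n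
    refine ⟨coeff r.order.toNat s, ?_⟩
    rw [← coeff_map, ← halg, hs, Algebra.smul_def (A := K⟦X⟧), halg, Algebra.smul_def]
    obtain ⟨r', hr'⟩ := X_pow_order_dvd (φ := r)
    have h1 (φ : K⟦X⟧) (m : ℕ) : coeff m (X ^ m * φ) = coeff 0 φ := by
      simpa using coeff_X_pow_mul φ m 0
    have h2 (φ : D⟦X⟧) (m : ℕ) : coeff m (X ^ m * φ) = coeff 0 φ := by
      simpa using coeff_X_pow_mul φ m 0
    generalize r.order.toNat = m at hr'
    rw [hr', h2, map_mul (map (algebraMap D K)), map_pow (map (algebraMap D K)), map_X, mul_assoc, h1,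
      coeff_zero_eq_constantCoeff_apply, map_mul, map_pow, ← coeff_zero_eq_constantCoeff_apply,
      ← coeff_zero_eq_constantCoeff_apply, coeff_map]
  intro n
  induction n generalizing g with
  | zero => exact h0 hg
  | succ n ih =>
    obtain ⟨d, hd⟩ := h0 hg
    have hgX := sub_const_eq_X_mul_shift g
    rw [show (C (constantCoeff g) : K⟦X⟧) = algebraMap D⟦X⟧ K⟦X⟧ (C d) by
      rw [halg, map_C, hd, coeff_zero_eq_constantCoeff]] at hgX
    have hsub : IsAlmostIntegral D⟦X⟧ (g - algebraMap D⟦X⟧ K⟦X⟧ (C d)) :=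
      (completeIntegralClosure D⟦X⟧ K⟦X⟧).sub_mem hg (algebraMap_mem _ _)
    rw [hgX] at hsub
    have : IsAlmostIntegral D⟦X⟧ (mk fun p ↦ coeff (p + 1) g) := by
      obtain ⟨r, hr, hrg⟩ := hsub
      refine ⟨r, hr, fun n ↦ ?_⟩
      have h := hrg n
      rw [halg, map_range_iff] at h ⊢
      intro k
      have h := h (k + n)
      rwa [mul_pow, Algebra.smul_def, mul_left_comm, ← Algebra.smul_def, coeff_X_pow_mul] at h
    simpa using ih this

instance isIntegrallyClosed {D : Type*} [CommRing D] [IsDomain D] [IsNoetherianRing D]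
    [IsIntegrallyClosed D] : IsIntegrallyClosed D⟦X⟧ := by
  let K := FractionRing D
  let L := FractionRing D⟦X⟧
  let M := FractionRing K⟦X⟧
  have hinj : Function.Injective (map (algebraMap D K)) :=
    map_injective _ (IsFractionRing.injective D K)
  let : Algebra D⟦X⟧ K⟦X⟧ := (map (algebraMap D K)).toAlgebra
  have halg : algebraMap D⟦X⟧ K⟦X⟧ = map (algebraMap D K) := rfl
  rw [isIntegrallyClosed_iff L]
  intro x hx
  have hinjM : Function.Injective ((algebraMap K⟦X⟧ M).comp (map (algebraMap D K))) :=
    (IsFractionRing.injective K⟦X⟧ M).comp hinj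
  let ψ : L →+* M := IsFractionRing.lift hinjM
  have hψ (f : D⟦X⟧) : ψ (algebraMap D⟦X⟧ L f) = algebraMap K⟦X⟧ M (map (algebraMap D K) f) :=
    IsFractionRing.lift_algebraMap hinjM f
  have hψx : IsIntegral K⟦X⟧ (ψ x) := by
    obtain ⟨p, hp, hpx⟩ := hx
    refine ⟨p.map (map (algebraMap D K)), hp.map _, ?_⟩
    rw [Polynomial.eval₂_map, ← (RingHom.ext hψ : ψ.comp (algebraMap D⟦X⟧ L) = (algebraMap K⟦X⟧ M).comp (map (algebraMap D K))),
      ← Polynomial.hom_eval₂, hpx, map_zero]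
  obtain ⟨g, hg⟩ := IsIntegrallyClosed.isIntegral_iff.1 hψx
  obtain ⟨r, hr, hrx⟩ := hx.isAlmostIntegral
  obtain ⟨f, hf⟩ := mem_range_map_of_isAlmostIntegral halg (g := g) ⟨r, hr, fun n ↦ by
    obtain ⟨s, hs⟩ := hrx n
    refine ⟨s, IsFractionRing.injective _ M ?_⟩
    rw [halg, ← hψ, hs, Algebra.smul_def, Algebra.smul_def, map_mul, map_mul, halg, hψ, map_pow,
      map_pow, hg]⟩
  exact ⟨f, ψ.injective (by rw [hψ, hf, hg])⟩

/-- A power series over `D` can be evaluated at any element of the ideal of definition of an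
adically complete `D`-algebra. -/
lemma exists_ringHom_C_X {D R : Type*} [CommRing D] [CommRing R] (I : Ideal R)
    [IsAdicComplete I R] (φ : D →+* R) {t : R} (ht : t ∈ I) :
    ∃ ψ : D⟦X⟧ →+* R, (∀ d, ψ (C d) = φ d) ∧ ψ X = t := by
  have hdvd (n : ℕ) {P Q : Polynomial D} (h : ∀ i < n, P.coeff i = Q.coeff i) :
      Ideal.Quotient.mk (I ^ n) (P.eval₂ φ t) = Ideal.Quotient.mk (I ^ n) (Q.eval₂ φ t) := by
    rw [Ideal.Quotient.eq, ← Polynomial.eval₂_sub]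
    obtain ⟨S, hS⟩ : Polynomial.X ^ n ∣ P - Q :=
      Polynomial.X_pow_dvd_iff.2 fun i hi ↦ by simp [h i hi]
    rw [hS, Polynomial.eval₂_mul, Polynomial.eval₂_X_pow]
    exact Ideal.mul_mem_right _ _ (Ideal.pow_mem_pow ht n)
  let f (n : ℕ) : D⟦X⟧ →+* R ⧸ I ^ n :=
    { toFun := fun g ↦ Ideal.Quotient.mk (I ^ n) ((trunc n g).eval₂ φ t)
      map_zero' := by simp
      map_add' := by simp [Polynomial.eval₂_add]
      map_one' := by
        rw [hdvd n (Q := 1) fun i hi ↦ by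
          simp [coeff_trunc, hi, coeff_one, Polynomial.coeff_one], Polynomial.eval₂_one, map_one]
      map_mul' := fun g h ↦ by
        rw [← map_mul, ← Polynomial.eval₂_mul]
        refine hdvd n fun i hi ↦ ?_
        rw [← trunc_trunc_mul_trunc, coeff_trunc, if_pos hi, ← Polynomial.coe_mul,
          Polynomial.coeff_coe] }
  have hf {m n : ℕ} (hle : m ≤ n) : (Ideal.Quotient.factorPow I hle).comp (f n) = f m := by
    ext1 g
    refine hdvd m fun i hi ↦ ?_
    simp [coeff_trunc, hi, hi.trans_le hle]
  have hext {x y : R} (h : ∀ n, Ideal.Quotient.mk (I ^ n) x = Ideal.Quotient.mk (I ^ n) y) :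
      x = y := by
    rw [IsHausdorff.eq_iff_smodEq (I := I)]
    intro n
    rw [smul_eq_mul, Ideal.mul_top, SModEq.sub_mem]
    exact Ideal.Quotient.eq.1 (h n)
  refine ⟨IsAdicComplete.liftRingHom I f hf, fun d ↦ hext fun n ↦ ?_, hext fun n ↦ ?_⟩
  · rw [IsAdicComplete.mk_liftRingHom]
    refine (hdvd n (Q := .C d) fun i hi ↦ ?_).trans (by simp)
    simp [coeff_trunc, hi, coeff_C, Polynomial.coeff_C]
  · rw [IsAdicComplete.mk_liftRingHom]
    refine (hdvd n (Q := .X) fun i hi ↦ ?_).trans (by simp)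
    simp [coeff_trunc, hi, coeff_X, Polynomial.coeff_X, eq_comm]

end PowerSeries

/-- Ideals of a Noetherian local ring are closed in the adic topology. -/
lemma Ideal.mem_of_forall_mem_sup_pow {R : Type*} [CommRing R] [IsNoetherianRing R]
    [IsLocalRing R] {I J : Ideal R} (hI : I ≠ ⊤) {x : R} (hx : ∀ n, x ∈ J ⊔ I ^ n) : x ∈ J := by
  have h := Ideal.iInf_pow_smul_eq_bot_of_isLocalRing (M := R ⧸ J) I hI
  rw [← Ideal.Quotient.eq_zero_iff_mem, ← Submodule.mem_bot R, ← h, Submodule.mem_iInf]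
  intro n
  obtain ⟨j, hj, i, hi, rfl⟩ := Submodule.mem_sup.1 (hx n)
  rw [map_add, Ideal.Quotient.eq_zero_iff_mem.2 hj, zero_add,
    show Ideal.Quotient.mk J i = i • (1 : R ⧸ J) by
      rw [Algebra.smul_def, mul_one]; rfl]
  exact Submodule.smul_mem_smul hi trivial

/-- The geometric series `∑ k, x ^ k * d (n + k)` can be summed in `D`. -/
def HasGeometricSums {D : Type*} [CommRing D] (x : D) : Prop :=
  ∀ d : ℕ → D, ∃ e : ℕ → D, ∀ n, e n = d n + x * e (n + 1)

lemma hasGeometricSums_zero {D : Type*} [CommRing D] : HasGeometricSums (0 : D) :=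
  fun d ↦ ⟨d, by simp⟩

lemma PowerSeries.hasGeometricSums_X {D : Type*} [CommRing D] :
    HasGeometricSums (X : PowerSeries D) := fun d ↦ by
  refine ⟨fun n ↦ mk fun m ↦ ∑ j ∈ Finset.range (m + 1), coeff (m - j) (d (n + j)), fun n ↦ ?_⟩
  ext m
  cases m with
  | zero => simp
  | succ m =>
    rw [map_add, coeff_succ_X_mul, coeff_mk, coeff_mk, Finset.sum_range_succ', add_comm]
    simp only [tsub_zero, add_zero, Nat.add_sub_add_right, Nat.add_assoc, Nat.add_comm 1]

/-- The elements `e i` generate `R` modulo `J` as a module over the image of `φ`. -/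
def Ideal.IsGeneratedModulo {D R : Type*} [CommRing D] [CommRing R] (J : Ideal R) (φ : D →+* R)
    {n : ℕ} (e : Fin n → R) : Prop :=
  ∀ r, ∃ d : Fin n → D, r - ∑ i, φ (d i) * e i ∈ J

/-- A form of Nakayama's lemma for complete rings. -/
lemma Ideal.IsGeneratedModulo.of_sup_span {D R : Type*} [CommRing D] [CommRing R]
    [IsNoetherianRing R] [IsLocalRing R] {J : Ideal R} {φ : D →+* R} {n : ℕ} {e : Fin n → R}
    {x : D} (hx : HasGeometricSums x) (hxm : φ x ∈ IsLocalRing.maximalIdeal R)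
    (h : (J ⊔ Ideal.span {φ x}).IsGeneratedModulo φ e) : J.IsGeneratedModulo φ e := by
  have h' (r : R) : ∃ (d : Fin n → D) (s : R), r - ∑ i, φ (d i) * e i - φ x * s ∈ J := by
    obtain ⟨d, hd⟩ := h r
    obtain ⟨j, hj, y, hy, hjy⟩ := Submodule.mem_sup.1 hd
    obtain ⟨s, rfl⟩ := Ideal.mem_span_singleton'.1 hy
    exact ⟨d, s, by rwa [← hjy, mul_comm, add_sub_cancel_right]⟩
  choose d s hds using h'
  intro r
  let r' (k : ℕ) : R := s^[k] r
  choose E hE using fun i ↦ hx fun k ↦ d (r' k) i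
  refine ⟨fun i ↦ E i 0, Ideal.mem_of_forall_mem_sup_pow (I := IsLocalRing.maximalIdeal R)
    (Ideal.IsPrime.ne_top inferInstance) fun N ↦ ?_⟩
  let v (k : ℕ) : R := r' k - ∑ i, φ (E i k) * e i
  have hv (k : ℕ) : v k - φ x * v (k + 1) ∈ J := by
    have : v k - φ x * v (k + 1) = r' k - ∑ i, φ (d (r' k) i) * e i - φ x * s (r' k) := by
      have hr : r' (k + 1) = s (r' k) := Function.iterate_succ_apply' s k r
      have hs : ∑ i, φ (E i k) * e i =
          ∑ i, φ (d (r' k) i) * e i + φ x * ∑ i, φ (E i (k + 1)) * e i := by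
        rw [Finset.mul_sum, ← Finset.sum_add_distrib]
        refine Finset.sum_congr rfl fun i _ ↦ ?_
        rw [hE i k, map_add, map_mul]; ring
      simp only [v, hs, hr]; ring
    rw [this]
    exact hds _
  suffices ∀ k, v k ∈ J ⊔ IsLocalRing.maximalIdeal R ^ N from this 0
  induction N with
  | zero => simp
  | succ N ih =>
    intro k
    rw [← sub_add_cancel (v k) (φ x * v (k + 1))]
    refine add_mem (le_sup_left (α := Ideal R) (hv k)) ?_
    obtain ⟨j, hj, y, hy, hjy⟩ := Submodule.mem_sup.1 (ih (k + 1))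
    rw [← hjy, mul_add, pow_succ']
    exact Submodule.add_mem_sup (J.mul_mem_left _ hj) (Ideal.mul_mem_mul hxm hy)

lemma Ideal.IsGeneratedModulo.finite {D R : Type*} [CommRing D] [CommRing R] {φ : D →+* R} {n : ℕ}
    {e : Fin n → R} (h : (⊥ : Ideal R).IsGeneratedModulo φ e) : φ.Finite := by
  let := φ.toAlgebra
  refine ⟨Submodule.fg_iff_exists_fin_generating_family.2 ⟨n, e, eq_top_iff.2 fun r _ ↦ ?_⟩⟩
  obtain ⟨d, hd⟩ := h r
  rw [Submodule.mem_span_range_iff_exists_fun]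
  exact ⟨d, (sub_eq_zero.1 (Ideal.mem_bot.1 hd)).symm⟩

/-- If `D` surjects onto the residue field of a Noetherian local ring `R`, then `R` is finite
over `D` modulo each power of the maximal ideal. -/
lemma IsLocalRing.exists_isGeneratedModulo_pow {D R : Type*} [CommRing D] [CommRing R]
    [IsNoetherianRing R] [IsLocalRing R] {φ : D →+* R} (h : ∀ r, ∃ d, r - φ d ∈ maximalIdeal R)
    (N : ℕ) : ∃ (n : ℕ) (e : Fin n → R), (maximalIdeal R ^ N).IsGeneratedModulo φ e := by
  induction N with
  | zero => exact ⟨0, Fin.elim0, fun r ↦ ⟨Fin.elim0, by simp⟩⟩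
  | succ N ih =>
    obtain ⟨n, e, he⟩ := ih
    obtain ⟨m, f, hf⟩ := Submodule.fg_iff_exists_fin_generating_family.1
      (IsNoetherian.noetherian (maximalIdeal R ^ N))
    refine ⟨n + m, Fin.append e f, fun r ↦ ?_⟩
    obtain ⟨d, hd⟩ := he r
    rw [← hf, Submodule.mem_span_range_iff_exists_fun] at hd
    obtain ⟨c, hc⟩ := hd
    choose c' hc' using fun i ↦ h (c i)
    refine ⟨Fin.append d c', ?_⟩
    simp only [Fin.sum_univ_add, Fin.append_left, Fin.append_right]
    rw [← sub_sub, ← hc, ← Finset.sum_sub_distrib, pow_succ']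
    refine sum_mem fun i _ ↦ ?_
    rw [smul_eq_mul, ← sub_mul]
    refine Ideal.mul_mem_mul (hc' i) ?_
    rw [← hf]
    exact Submodule.subset_span ⟨i, rfl⟩

lemma PowerSeries.ringKrullDim_le_add_one {D : Type*} [CommRing D] [IsDomain D]
    [IsNoetherianRing D] [IsLocalRing D] : ringKrullDim D⟦X⟧ ≤ ringKrullDim D + 1 := by
  have hX : (X : D⟦X⟧) ∈ Ring.jacobson D⟦X⟧ := by
    rw [IsLocalRing.ringJacobson_eq_maximalIdeal, IsLocalRing.mem_maximalIdeal, mem_nonunits_iff,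
      isUnit_iff_constantCoeff]
    simp
  rw [← ringKrullDim_quotient_span_singleton_succ_eq_ringKrullDim_of_mem_jacobson
    (.of_ne_zero X_ne_zero) hX]
  gcongr
  refine ringKrullDim_le_of_surjective
    ((Ideal.Quotient.mk (Ideal.span {(X : D⟦X⟧)})).comp C) fun f ↦ ?_
  obtain ⟨f, rfl⟩ := Ideal.Quotient.mk_surjective f
  refine ⟨constantCoeff f, Ideal.Quotient.eq.2 (Ideal.mem_span_singleton.2 (X_dvd_iff.2 ?_))⟩
  simp

/-- Adjoining power series variables which map to the elements of `l` to a normal Noetherian local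
domain over which `R` is finite modulo `l` gives one over which `R` is finite. -/
lemma IsLocalRing.exists_isGeneratedModulo_bot {R : Type u} [CommRing R] [IsNoetherianRing R]
    [IsLocalRing R] [IsAdicComplete (maximalIdeal R) R] {n : ℕ} {e : Fin n → R} (l : List R)
    (hl : ∀ t ∈ l, t ∈ maximalIdeal R) (A : Type u) [CommRing A] [IsDomain A] [IsNoetherianRing A]
    [IsIntegrallyClosed A] [IsLocalRing A] (φ : A →+* R)
    (h : (Ideal.span {t | t ∈ l}).IsGeneratedModulo φ e) :
    ∃ (B : Type u) (_ : CommRing B) (_ : IsDomain B) (_ : IsNoetherianRing B)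
      (_ : IsIntegrallyClosed B) (ψ : B →+* R), (⊥ : Ideal R).IsGeneratedModulo ψ e ∧
        ringKrullDim B ≤ ringKrullDim A + l.length := by
  induction l generalizing A with
  | nil => exact ⟨A, _, ‹_›, ‹_›, ‹_›, φ, by simpa using h, by simp⟩
  | cons t l ih =>
    rw [List.forall_mem_cons] at hl
    obtain ⟨ψ, hψC, hψX⟩ := PowerSeries.exists_ringHom_C_X (maximalIdeal R) φ hl.1
    obtain ⟨B, _, _, _, _, χ, hχ, hdim⟩ := ih hl.2 A⟦X⟧ ψ
      (.of_sup_span PowerSeries.hasGeometricSums_X (hψX ▸ hl.1) fun r ↦ by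
        obtain ⟨d, hd⟩ := h r
        refine ⟨fun i ↦ PowerSeries.C (d i), ?_⟩
        rw [hψX, ← Ideal.span_union]
        simp only [hψC]
        convert hd using 2
        ext x; simp)
    refine ⟨B, _, ‹_›, ‹_›, ‹_›, χ, hχ, hdim.trans ?_⟩
    rw [List.length_cons, Nat.cast_add, Nat.cast_one, add_comm (l.length : WithBot ℕ∞), ← add_assoc]
    gcongr
    exact PowerSeries.ringKrullDim_le_add_one

/-- `C` is a coefficient ring of `R` with uniformizer `ϖ`, which is either a discrete valuation
ring or a field. -/
structure IsLocalRing.IsCoefficientRing {R : Type*} [CommRing R] [IsLocalRing R] (C : Subring R)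
    (ϖ : C) : Prop where
  exists_sub_mem : ∀ r, ∃ c ∈ C, r - c ∈ maximalIdeal R
  mem_span_of_mem : ∀ c : C, (c : R) ∈ maximalIdeal R → c ∈ Ideal.span {ϖ}
  isPrincipalIdealRing : IsPrincipalIdealRing C
  coe_mem : (ϖ : R) ∈ maximalIdeal R
  hasGeometricSums : HasGeometricSums ϖ
  isLocalHom : IsLocalHom C.subtype

lemma Algebra.FormallySmooth.of_charZero {K L : Type*} [Field K] [Field L] [Algebra K L]
    [CharZero K] : Algebra.FormallySmooth K L := by
  obtain ⟨s, hs⟩ := exists_isTranscendenceBasis K L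
  have := hs.isAlgebraic_field
  exact .of_algebraicIndependent_of_isSeparable hs.1

/-- A complete local ring of residue characteristic zero contains its residue field. -/
lemma IsLocalRing.exists_isCoefficientRing_of_charZero (R : Type*) [CommRing R]
    [IsLocalRing R] [IsAdicComplete (maximalIdeal R) R] [CharZero (ResidueField R)] :
    ∃ (C : Subring R) (ϖ : C), IsCoefficientRing C ϖ := by
  have hchar (I : Ideal R) (hI : I ≠ ⊤) : CharZero (R ⧸ I) :=
    ⟨fun m n h ↦ Nat.cast_injective (R := ResidueField R) <| by
      have := congr(Ideal.Quotient.factor (le_maximalIdeal hI) $h)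
      rw [map_natCast, map_natCast] at this
      exact this⟩
  obtain ⟨_⟩ := (EqualCharZero.nonempty_algebraRat_iff R).2 hchar
  have : Algebra.FormallySmooth ℚ (R ⧸ maximalIdeal R) :=
    @Algebra.FormallySmooth.of_charZero ℚ (ResidueField R) _ _
      (Ideal.instAlgebraQuotient ℚ (maximalIdeal R)) _
  obtain ⟨g', hg⟩ := Algebra.FormallySmooth.exists_mkₐ_comp_eq_of_isAdicComplete
    (I := maximalIdeal R) (AlgHom.id ℚ (R ⧸ maximalIdeal R))
  let g : ResidueField R →+* R := g'.toRingHom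
  have hg' (x : ResidueField R) : residue R (g x) = x := congr($hg x)
  refine ⟨g.range, 0, ?_, ?_, ?_, ?_, hasGeometricSums_zero, ⟨?_⟩⟩
  · exact fun r ↦ ⟨g (residue R r), ⟨_, rfl⟩, by rw [← residue_eq_zero_iff, map_sub, hg', sub_self]⟩
  · rintro ⟨_, x, rfl⟩ hx
    obtain rfl : x = 0 := by rw [← hg' x]; exact (residue_eq_zero_iff _).2 hx
    exact Ideal.mem_span_singleton.2 ⟨0, Subtype.ext (by simp)⟩
  · exact .of_surjective g.rangeRestrict g.rangeRestrict_surjective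
  · simp
  · rintro ⟨_, x, rfl⟩ hx
    have hx0 : x ≠ 0 := by rintro rfl; exact not_isUnit_zero (M₀ := R) (by rw [← map_zero g]; exact hx)
    exact hx0.isUnit.map g.rangeRestrict

/-- A form of the Cohen structure theorem: a ring of characteristic `p` which is an extension of a
field `k` by an ideal killed by Frobenius contains a copy of `k`. -/
lemma exists_subring_of_pow_eq_zero {E k : Type*} [CommRing E] [Field k] (p : ℕ) [hp : Fact p.Prime]
    [CharP E p] (π : E →+* k) (hπ : Function.Surjective π) (h : ∀ x, π x = 0 → x ^ p = 0) :
    ∃ M : Subring E, (∀ x ∈ M, π x = 0 → x = 0) ∧ ∀ y, ∃ x ∈ M, π x = y := by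
  have : CharP k p := by
    rw [← CharP.ringChar_of_prime_eq_zero (R := k) hp.out (by
      rw [← map_natCast π, CharP.cast_eq_zero, map_zero])]
    infer_instance
  obtain ⟨M, hFM, hM⟩ := zorn_le_nonempty₀
    {M : Subring E | (frobenius E p).range ≤ M ∧ ∀ x ∈ M, π x = 0 → x = 0} (fun c hc hch M hM ↦ by
      have hdir := hch.directedOn
      refine ⟨sSup c, ⟨(hc hM).1.trans (le_sSup hM), fun x hx ↦ ?_⟩, fun z hz ↦ le_sSup hz⟩
      obtain ⟨N, hN, hxN⟩ := (Subring.mem_sSup_of_directedOn ⟨M, hM⟩ hdir).1 hx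
      exact (hc hN).2 x hxN) (frobenius E p).range ⟨le_rfl, by
        rintro _ ⟨x, rfl⟩ hx
        rw [frobenius_def] at *
        exact h x (by simpa [hp.out.ne_zero] using hx)⟩
  obtain ⟨-, hinj⟩ := hM.prop
  refine ⟨M, hinj, fun y ↦ ?_⟩
  obtain ⟨b, rfl⟩ := hπ y
  have hfrob (x : E) : x ^ p ∈ M := hFM ⟨x, rfl⟩
  have hinj' : Function.Injective (π.comp M.subtype) :=
    (injective_iff_map_eq_zero _).2 fun x hx ↦ Subtype.ext (hinj x x.2 hx)
  have hMf : IsField M := ⟨⟨0, 1, fun h01 ↦ by simpa using congr((π.comp M.subtype) $h01)⟩,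
    mul_comm, fun {x} hx ↦ by
      obtain ⟨y, hy⟩ := hπ (π x)⁻¹
      have hx' : π x ≠ 0 := fun h0 ↦ hx (hinj' (by simpa using h0))
      refine ⟨x ^ (p - 1) * ⟨y ^ p, hfrob y⟩, hinj' ?_⟩
      have : π x ^ (p - 1) * π x = π x ^ p := by rw [← pow_succ, Nat.sub_add_cancel hp.out.one_le]
      simp only [map_mul, RingHom.comp_apply, Subring.subtype_apply, map_pow, hy,
        inv_pow, map_one]
      rw [← mul_assoc, mul_comm (π x), this, mul_inv_cancel₀ (pow_ne_zero _ hx')]⟩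
  let := hMf.toField
  by_contra! hb
  let c : M := ⟨b ^ p, hfrob b⟩
  have hirr : Irreducible (Polynomial.X ^ p - Polynomial.C c) := by
    refine X_pow_sub_C_irreducible_of_prime hp.out fun x hx ↦ hb x x.2 ?_
    refine frobenius_inj k p ?_
    rw [frobenius_def, frobenius_def, ← map_pow, ← map_pow]
    exact congr(π ($hx : M))
  let ψ : Polynomial M →+* E := Polynomial.eval₂RingHom M.subtype b
  have hψ : ψ (Polynomial.X ^ p - Polynomial.C c) = 0 := by simp [ψ, c]
  refine hb b (hM.le_of_ge (y := ψ.range) ⟨?_, ?_⟩ ?_ ⟨Polynomial.X, by simp [ψ]⟩) rfl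
  · exact hFM.trans fun x hx ↦ ⟨Polynomial.C ⟨x, hx⟩, by simp [ψ]⟩
  · rintro _ ⟨f, rfl⟩ hf
    by_contra hf0
    obtain ⟨u, v, huv⟩ := (hirr.coprime_iff_not_dvd (n := f)).2 fun ⟨q, hq⟩ ↦ hf0 (by
      rw [hq, map_mul, hψ, zero_mul])
    have := congr(π (ψ $huv))
    simp [hf, hψ] at this
  · exact fun x hx ↦ ⟨Polynomial.C ⟨x, hx⟩, by simp [ψ]⟩

/-- `S` approximates a coefficient ring of `R` with uniformizer `p` up to order `n`. -/
structure IsLocalRing.IsApproxCoefficientRing {R : Type*} [CommRing R] [IsLocalRing R] (p n : ℕ)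
    (S : Subring R) : Prop where
  exists_sub_mem : ∀ r, ∃ s ∈ S, r - s ∈ maximalIdeal R
  mem_of_mem_pow : ∀ r ∈ maximalIdeal R ^ (n + 1), r ∈ S
  exists_sub_mul_mem : ∀ s ∈ S, s ∈ maximalIdeal R → ∃ t ∈ S, s - p * t ∈ maximalIdeal R ^ (n + 1)

lemma IsLocalRing.IsApproxCoefficientRing.top {R : Type*} [CommRing R] [IsLocalRing R] (p : ℕ) :
    IsApproxCoefficientRing p 0 (⊤ : Subring R) where
  exists_sub_mem r := ⟨r, trivial, by simp⟩
  mem_of_mem_pow _ _ := trivial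
  exists_sub_mul_mem s _ hs := ⟨0, trivial, by simpa using hs⟩

lemma IsLocalRing.IsApproxCoefficientRing.exists_succ {R : Type*} [CommRing R] [IsLocalRing R]
    {p n : ℕ} [hp : Fact p.Prime] (hpm : (p : R) ∈ maximalIdeal R) {S : Subring R}
    (hS : IsApproxCoefficientRing p n S) :
    ∃ S' : Subring R, IsApproxCoefficientRing p (n + 1) S' ∧ S' ≤ S ∧
      ∀ s ∈ S, ∃ s' ∈ S', s - s' ∈ maximalIdeal R ^ (n + 1) := by
  let J : Ideal S := Ideal.span {(p : S)} ⊔ (maximalIdeal R ^ (n + 2)).comap S.subtype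
  let π : S ⧸ J →+* ResidueField R := Ideal.Quotient.lift J ((residue R).comp S.subtype) <| by
    suffices J ≤ RingHom.ker ((residue R).comp S.subtype) from fun x hx ↦ this hx
    refine sup_le ?_ fun x hx ↦ ?_
    · rw [Ideal.span_singleton_le_iff_mem, RingHom.mem_ker, map_natCast, ← map_natCast (residue R),
        residue_eq_zero_iff]
      exact hpm
    · exact (residue_eq_zero_iff _).2 (Ideal.pow_le_self (Nat.succ_ne_zero (n + 1)) hx)
  have hπ (s : S) : π (Ideal.Quotient.mk J s) = residue R s := rfl
  have := π.domain_nontrivial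
  have : CharP (S ⧸ J) p := by
    rw [← CharP.ringChar_of_prime_eq_zero (R := S ⧸ J) hp.out (by
      rw [← map_natCast (Ideal.Quotient.mk J), Ideal.Quotient.eq_zero_iff_mem]
      exact Ideal.mem_sup_left (Ideal.mem_span_singleton_self _))]
    infer_instance
  obtain ⟨M, hM, hM'⟩ := exists_subring_of_pow_eq_zero p π
    (fun y ↦ by
      obtain ⟨r, rfl⟩ := residue_surjective y
      obtain ⟨s, hs, hrs⟩ := hS.exists_sub_mem r
      exact ⟨Ideal.Quotient.mk J ⟨s, hs⟩, by
        rwa [hπ, eq_comm, ← sub_eq_zero, ← map_sub, residue_eq_zero_iff]⟩)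
    (fun x hx ↦ by
      obtain ⟨⟨s, hs⟩, rfl⟩ := Ideal.Quotient.mk_surjective x
      rw [hπ, residue_eq_zero_iff] at hx
      obtain ⟨t, ht, hst⟩ := hS.exists_sub_mul_mem s hs hx
      have h : Ideal.Quotient.mk J ⟨s, hs⟩ = Ideal.Quotient.mk J ⟨_, hS.mem_of_mem_pow _ hst⟩ := by
        rw [Ideal.Quotient.eq]
        refine Ideal.mem_sup_left (Ideal.mem_span_singleton.2 ⟨⟨t, ht⟩, Subtype.ext ?_⟩)
        simp
      rw [h, ← map_pow, Ideal.Quotient.eq_zero_iff_mem]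
      have hpow := Ideal.pow_mem_pow hst p
      rw [← pow_mul] at hpow
      refine Ideal.mem_sup_right (Ideal.pow_le_pow_right (m := n + 2) ?_ hpow)
      nlinarith [hp.out.two_le])
  let S' : Subring R := (M.comap (Ideal.Quotient.mk J)).map S.subtype
  have hS'S : S' ≤ S := by
    rintro _ ⟨s, -, rfl⟩
    exact s.2
  have hsurj (r : R) : ∃ s ∈ S', r - s ∈ maximalIdeal R := by
    obtain ⟨x, hx, hxr⟩ := hM' (residue R r)
    obtain ⟨s, rfl⟩ := Ideal.Quotient.mk_surjective x
    refine ⟨s, ⟨s, hx, rfl⟩, ?_⟩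
    rw [← residue_eq_zero_iff, map_sub, ← hxr, hπ, sub_self]
  have happrox (t : R) (ht : t ∈ S) : ∃ s ∈ S', t - s ∈ maximalIdeal R ^ (n + 1) := by
    have h (j : ℕ) : ∃ s ∈ S', ∃ w ∈ S, t - s - p ^ j * w ∈ maximalIdeal R ^ (n + 1) := by
      induction j with
      | zero => exact ⟨0, zero_mem _, t, ht, by simp⟩
      | succ j ih =>
        obtain ⟨s, hs, w, hw, h⟩ := ih
        obtain ⟨s', hs', hws⟩ := hsurj w
        obtain ⟨w', hw', h'⟩ := hS.exists_sub_mul_mem (w - s') (sub_mem hw (hS'S hs')) hws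
        refine ⟨s + p ^ j * s', add_mem hs (mul_mem (pow_mem (natCast_mem _ _) _) hs'), w', hw', ?_⟩
        convert add_mem h (Ideal.mul_mem_left _ ((p : R) ^ j) h') using 1
        ring
    obtain ⟨s, hs, w, hw, h⟩ := h (n + 1)
    refine ⟨s, hs, ?_⟩
    rw [← sub_add_cancel (t - s) (p ^ (n + 1) * w)]
    exact add_mem h (Ideal.mul_mem_right _ _ (Ideal.pow_mem_pow hpm _))
  refine ⟨S', ⟨hsurj, fun r hr ↦ ?_, ?_⟩, hS'S, happrox⟩
  · refine ⟨⟨r, hS.mem_of_mem_pow r (Ideal.pow_le_pow_right (by simp) hr)⟩, ?_, rfl⟩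
    have h0 : Ideal.Quotient.mk J ⟨r, hS.mem_of_mem_pow r (Ideal.pow_le_pow_right (by simp) hr)⟩ = 0 :=
      Ideal.Quotient.eq_zero_iff_mem.2 (Ideal.mem_sup_right hr)
    exact Subring.mem_comap.2 (h0 ▸ zero_mem M)
  · rintro _ ⟨s, hsM, rfl⟩ hs
    have hs0 := hM _ hsM ((residue_eq_zero_iff _).2 hs)
    rw [Ideal.Quotient.eq_zero_iff_mem, Ideal.mem_span_singleton_sup] at hs0
    obtain ⟨t, b, hb, rfl⟩ := hs0
    obtain ⟨t', ht', htt'⟩ := happrox t t.2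
    refine ⟨t', ht', ?_⟩
    have hmul := Ideal.mul_mem_mul hpm htt'
    rw [← pow_succ'] at hmul
    convert add_mem hmul (Ideal.mem_comap.1 hb) using 1
    simp only [map_add, map_mul, map_natCast, Subring.subtype_apply]
    ring

lemma IsLocalRing.exists_isApproxCoefficientRing (R : Type*) [CommRing R] [IsLocalRing R]
    {p : ℕ} [Fact p.Prime] (hpm : (p : R) ∈ maximalIdeal R) :
    ∃ S : ℕ → Subring R, Antitone S ∧ ∀ n, IsApproxCoefficientRing p n (S n) ∧
      ∀ s ∈ S n, ∃ s' ∈ S (n + 1), s - s' ∈ maximalIdeal R ^ (n + 1) := by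
  choose f hf hle hsub using fun n (S : {S : Subring R // IsApproxCoefficientRing p n S}) ↦
    S.2.exists_succ hpm
  let S (n : ℕ) : {S : Subring R // IsApproxCoefficientRing p n S} :=
    Nat.rec ⟨⊤, .top p⟩ (fun n S ↦ ⟨f n S, hf n S⟩) n
  exact ⟨fun n ↦ (S n).1, antitone_nat_of_succ_le fun n ↦ hle n (S n), fun n ↦ ⟨(S n).2, hsub n (S n)⟩⟩

lemma IsPrincipalIdealRing.of_isUnit_or_dvd {D : Type*} [CommRing D] {ϖ : D}
    (h : ∀ c, IsUnit c ∨ ϖ ∣ c) (h0 : ∀ c, (∀ n, ϖ ^ n ∣ c) → c = 0) :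
    IsPrincipalIdealRing D := by
  have hassoc (c : D) (hc : c ≠ 0) : ∃ n, Associated (ϖ ^ n) c := by
    by_contra! hn
    refine hc (h0 c fun n ↦ ?_)
    induction n with
    | zero => simp
    | succ n ih =>
      obtain ⟨x, rfl⟩ := ih
      exact (h x).elim (fun hx ↦ (hn n ⟨hx.unit, rfl⟩).elim) fun hx ↦
        (pow_succ ϖ n) ▸ mul_dvd_mul_left _ hx
  refine ⟨fun I ↦ ?_⟩
  by_cases hI : ∃ n, ϖ ^ n ∈ I
  · classical
    refine ⟨ϖ ^ Nat.find hI, le_antisymm (fun c hc ↦ ?_) ?_⟩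
    · rcases eq_or_ne c 0 with rfl | hc0
      · exact zero_mem _
      obtain ⟨m, hm⟩ := hassoc c hc0
      exact Ideal.mem_span_singleton.2
        ((pow_dvd_pow ϖ (Nat.find_min' hI (I.mem_of_dvd hm.symm.dvd hc))).trans hm.dvd)
    · exact (Ideal.span_singleton_le_iff_mem _).2 (Nat.find_spec hI)
  · refine ⟨0, ?_⟩
    rw [Submodule.span_zero_singleton, eq_bot_iff]
    intro c hc
    by_contra hc0
    obtain ⟨m, hm⟩ := hassoc c hc0
    exact hI ⟨m, I.mem_of_dvd hm.symm.dvd hc⟩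

/-- Power series in a topologically nilpotent element of a closed subring can be summed. -/
lemma Subring.hasGeometricSums {R : Type*} [CommRing R] (I : Ideal R) [IsAdicComplete I R]
    {C : Subring R} (hC : ∀ r, (∀ n, ∃ c ∈ C, r - c ∈ I ^ n) → r ∈ C) {x : C} (hx : (x : R) ∈ I) :
    HasGeometricSums x := fun d ↦ by
  obtain ⟨ψ, hψC, hψX⟩ := PowerSeries.exists_ringHom_C_X I C.subtype hx
  have hψ (f : C⟦X⟧) : ψ f ∈ C := by
    refine hC _ fun n ↦ ⟨ψ (PowerSeries.trunc n f), ?_, ?_⟩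
    · induction PowerSeries.trunc n f using Polynomial.induction_on' with
      | add f g hf hg => simpa using add_mem hf hg
      | monomial m a =>
        rw [← Polynomial.C_mul_X_pow_eq_monomial]
        simpa [hψC, hψX] using mul_mem a.2 (pow_mem x.2 m)
    · obtain ⟨g, hg⟩ : PowerSeries.X ^ n ∣ f - (PowerSeries.trunc n f : C⟦X⟧) :=
        PowerSeries.X_pow_dvd_iff.2 fun i hi ↦ by simp [PowerSeries.coeff_trunc, hi]
      rw [← map_sub, hg, map_mul, map_pow, hψX]
      exact Ideal.mul_mem_right _ _ (Ideal.pow_mem_pow hx n)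
  refine ⟨fun n ↦ ⟨_, hψ (PowerSeries.mk fun j ↦ d (n + j))⟩, fun n ↦ Subtype.ext ?_⟩
  have h : (PowerSeries.mk fun j ↦ d (n + j)) =
      PowerSeries.C (d n) + PowerSeries.X * PowerSeries.mk fun j ↦ d (n + 1 + j) := by
    ext1 j
    cases j with
    | zero => simp
    | succ j => simp [PowerSeries.coeff_succ_X_mul, add_assoc, add_comm 1]
  simp [h, hψC, hψX]

lemma IsLocalRing.exists_isCoefficientRing_of_natCast_mem (R : Type*) [CommRing R] [IsDomain R]
    [IsNoetherianRing R] [IsLocalRing R] [IsAdicComplete (maximalIdeal R) R] {p : ℕ}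
    [Fact p.Prime] (hpm : (p : R) ∈ maximalIdeal R) :
    ∃ (C : Subring R) (ϖ : C), IsCoefficientRing C ϖ := by
  obtain ⟨S, hanti, hS⟩ := exists_isApproxCoefficientRing R hpm
  have htop : maximalIdeal R ≠ ⊤ := Ideal.IsPrime.ne_top inferInstance
  let C : Subring R := ⨅ n, S n
  have hCmem (r : R) : r ∈ C ↔ ∀ n, r ∈ S n := Subring.mem_iInf
  have hclosed (r : R) (h : ∀ n, ∃ c ∈ C, r - c ∈ maximalIdeal R ^ n) : r ∈ C := by
    rw [hCmem]
    intro n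
    obtain ⟨c, hc, hrc⟩ := h (n + 1)
    rw [← sub_add_cancel r c]
    exact add_mem ((hS n).1.mem_of_mem_pow _ hrc) ((hCmem c).1 hc n)
  have hsurj (r : R) : ∃ c ∈ C, r - c ∈ maximalIdeal R := by
    obtain ⟨s, hs, hrs⟩ := (hS 0).1.exists_sub_mem r
    choose f hf hsub using fun n (s : {s // s ∈ S n}) ↦ (hS n).2 s s.2
    let x (n : ℕ) : {s // s ∈ S n} := Nat.rec ⟨s, hs⟩ (fun n s ↦ ⟨f n s, hf n s⟩) n
    have hx (n : ℕ) : (x n).1 - (x (n + 1)).1 ∈ maximalIdeal R ^ (n + 1) := hsub n (x n)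
    obtain ⟨c, hc⟩ := IsPrecomplete.prec (I := maximalIdeal R) (M := R) inferInstance
      (f := fun n ↦ (x n).1) fun {m n} hmn ↦ by
        induction n, hmn using Nat.le_induction with
        | base => rfl
        | succ n hmn ih =>
          refine ih.trans (SModEq.sub_mem.2 ?_)
          rw [smul_eq_mul, Ideal.mul_top]
          exact Ideal.pow_le_pow_right (hmn.trans n.le_succ) (hx n)
    simp only [SModEq.sub_mem, smul_eq_mul, Ideal.mul_top] at hc
    refine ⟨c, (hCmem c).2 fun n ↦ ?_, ?_⟩
    · rw [← sub_sub_cancel (x (n + 1)).1 c]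
      exact sub_mem (hanti n.le_succ (x (n + 1)).2) ((hS n).1.mem_of_mem_pow _ (hc _))
    · have h0 := hx 0
      have h1 := hc 1
      rw [zero_add, pow_one] at h0
      rw [pow_one] at h1
      convert add_mem (add_mem hrs h0) h1 using 1
      simp [x]
  have hmul (c : C) (hc : (c : R) ∈ maximalIdeal R) : (p : C) ∣ c := by
    choose t ht hct using fun n ↦ (hS n).1.exists_sub_mul_mem c ((hCmem c).1 c.2 n) hc
    have hcp : (c : R) ∈ Ideal.span {(p : R)} := Ideal.mem_of_forall_mem_sup_pow htop fun n ↦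
      Ideal.mem_span_singleton_sup.2 ⟨t n, _, Ideal.pow_le_pow_right n.le_succ (hct n), by ring⟩
    obtain ⟨r, hr⟩ := Ideal.mem_span_singleton'.1 hcp
    rcases eq_or_ne (p : R) 0 with hp0 | hp0
    · exact ⟨0, Subtype.ext (by simp [← hr, hp0])⟩
    obtain ⟨k, hk⟩ := (maximalIdeal R).exists_pow_inf_eq_pow_smul (Ideal.span {(p : R)})
    suffices r ∈ C from ⟨⟨r, this⟩, Subtype.ext (by simp [← hr, mul_comm])⟩
    rw [hCmem]
    intro j
    have h : p * (r - t (j + k)) ∈ maximalIdeal R ^ (j + k + 1) • (⊤ : Ideal R) ⊓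
        Ideal.span {(p : R)} := by
      refine ⟨?_, Ideal.mul_mem_right _ _ (Ideal.mem_span_singleton_self _)⟩
      have := hct (j + k)
      rwa [← hr, mul_comm r, ← mul_sub, ← Ideal.mul_top (maximalIdeal R ^ _)] at this
    rw [hk _ (by lia)] at h
    obtain ⟨z, hz, hpz⟩ := Ideal.mem_mul_span_singleton.1
      (Submodule.smul_mono le_rfl inf_le_right h)
    rw [mul_comm, mul_right_inj' hp0] at hpz
    rw [← sub_add_cancel r (t (j + k)), ← hpz]
    refine add_mem ((hS j).1.mem_of_mem_pow _ (Ideal.pow_le_pow_right (by lia) hz))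
      (hanti (by lia) (ht (j + k)))
  have hunit : IsLocalHom C.subtype := ⟨fun c hc ↦ by
    obtain ⟨u, hu⟩ := hc.exists_right_inv
    refine .of_mul_eq_one ⟨u, hclosed u fun n ↦ ?_⟩ (Subtype.ext hu)
    change (c : R) * u = 1 at hu
    obtain ⟨c₁, hc₁, h₁⟩ := hsurj u
    induction n with
    | zero => exact ⟨0, zero_mem C, by simp⟩
    | succ n ih =>
      obtain ⟨x, hx, hux⟩ := ih
      refine ⟨x + c₁ * (1 - c * x), add_mem hx
        (mul_mem hc₁ (sub_mem (one_mem C) (mul_mem c.2 hx))), ?_⟩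
      rw [pow_succ]
      convert Ideal.mul_mem_left _ (c : R) (Ideal.mul_mem_mul hux h₁) using 1
      linear_combination (x - u + c₁) * hu⟩
  refine ⟨C, p, hsurj, fun c hc ↦ Ideal.mem_span_singleton.2 (hmul c hc),
    .of_isUnit_or_dvd (ϖ := (p : C)) (fun c ↦ ?_) fun c hc ↦ ?_, by simpa using hpm,
    Subring.hasGeometricSums (maximalIdeal R) hclosed (by simpa using hpm), hunit⟩
  · by_cases hc : (c : R) ∈ maximalIdeal R
    · exact .inr (hmul c hc)
    · exact .inl (hunit.map_nonunit c (notMem_maximalIdeal.1 hc))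
  · refine Subtype.ext (Ideal.mem_bot.1 (Ideal.mem_of_forall_mem_sup_pow htop fun n ↦ ?_))
    obtain ⟨x, rfl⟩ := hc n
    refine Ideal.mem_sup_right ?_
    simpa using Ideal.mul_mem_right _ _ (Ideal.pow_mem_pow hpm n)

lemma IsLocalRing.exists_isCoefficientRing (R : Type*) [CommRing R] [IsDomain R]
    [IsNoetherianRing R] [IsLocalRing R] [IsAdicComplete (maximalIdeal R) R] :
    ∃ (C : Subring R) (ϖ : C), IsCoefficientRing C ϖ := by
  obtain ⟨p, hp⟩ := CharP.exists (ResidueField R)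
  rcases CharP.char_is_prime_or_zero (ResidueField R) p with hprime | rfl
  · have : Fact p.Prime := ⟨hprime⟩
    refine exists_isCoefficientRing_of_natCast_mem R (p := p) ((residue_eq_zero_iff _).1 ?_)
    rw [map_natCast, CharP.cast_eq_zero]
  · have := CharP.charP_to_charZero (ResidueField R)
    exact exists_isCoefficientRing_of_charZero R

/-- A Noetherian local ring has a system of parameters. -/
lemma IsLocalRing.exists_list_maximalIdeal_pow_le (R : Type*) [CommRing R] [IsNoetherianRing R]
    [IsLocalRing R] : ∃ (l : List R) (N : ℕ), (∀ t ∈ l, t ∈ maximalIdeal R) ∧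
      maximalIdeal R ^ N ≤ Ideal.span {t | t ∈ l} ∧ (l.length : WithBot ℕ∞) = ringKrullDim R := by
  obtain ⟨s, hs, hcard⟩ := (maximalIdeal R).exists_finset_card_eq_height_of_isNoetherianRing
  obtain ⟨N, hN⟩ := Ideal.exists_pow_le_of_le_radical_of_fg (I := maximalIdeal R)
    (J := Ideal.span (s : Set R)) (by
      rw [← Ideal.sInf_minimalPrimes]
      refine le_sInf fun P hP ↦ hs.2 hP.1 (le_maximalIdeal hP.1.1.ne_top))
    (IsNoetherian.noetherian _)
  refine ⟨s.toList, N, fun t ht ↦ hs.1.2 (Ideal.subset_span (by simpa using ht)), ?_, ?_⟩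
  · simpa using! hN
  · rw [← maximalIdeal_height_eq_ringKrullDim, ← hcard]
    simp

/-- A finite ring homomorphism from a domain which does not decrease the dimension is injective. -/
lemma RingHom.IsIntegral.injective_of_ringKrullDim_le {A R : Type*} [CommRing A] [IsDomain A]
    [CommRing R] {φ : A →+* R} (hφ : φ.IsIntegral) (hA : ringKrullDim A ≤ ringKrullDim R)
    {n : ℕ} (hR : ringKrullDim R = n) : Function.Injective φ := by
  rw [injective_iff_map_eq_zero]
  intro x hx
  by_contra hx0
  let χ : A ⧸ Ideal.span {x} →+* R := Ideal.Quotient.lift _ φ fun y hy ↦ by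
    obtain ⟨z, rfl⟩ := Ideal.mem_span_singleton'.1 hy
    rw [map_mul, hx, mul_zero]
  let := χ.toAlgebra
  have : Algebra.IsIntegral (A ⧸ Ideal.span {x}) R := ⟨by
    refine RingHom.IsIntegral.tower_top (Ideal.Quotient.mk (Ideal.span {x})) χ ?_
    rwa [show χ.comp (Ideal.Quotient.mk (Ideal.span {x})) = φ from RingHom.ext fun _ ↦ rfl]⟩
  have h1 : ringKrullDim R ≤ ringKrullDim (A ⧸ Ideal.span {x}) :=
    Order.krullDim_le_of_strictMono _
      (PrimeSpectrum.comap_strictMono_of_isIntegral (A := A ⧸ Ideal.span {x}) (B := R))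
  have h2 := ringKrullDim_quotient_succ_le_of_nonZeroDivisor (mem_nonZeroDivisors_of_ne_zero hx0)
  have h3 := ((add_le_add_left h1 1).trans h2).trans hA
  rw [hR] at h3
  norm_cast at h3
  omega

/-- A complete Noetherian local domain is integral over a Noetherian integrally closed
subdomain. -/
lemma IsLocalRing.exists_isIntegral_of_isIntegrallyClosed (R : Type u) [CommRing R] [IsDomain R]
    [IsNoetherianRing R] [IsLocalRing R] [IsAdicComplete (maximalIdeal R) R] :
    ∃ (A : Type u) (_ : CommRing A) (_ : IsDomain A) (_ : IsNoetherianRing A)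
      (_ : IsIntegrallyClosed A) (φ : A →+* R), Function.Injective φ ∧ φ.IsIntegral := by
  obtain ⟨C, ϖ, hC⟩ := exists_isCoefficientRing R
  have := hC.isPrincipalIdealRing
  have hloc := hC.isLocalHom
  have hCloc : IsLocalRing C := RingHom.domain_isLocalRing C.subtype
  have hmax : maximalIdeal C = Ideal.span {ϖ} := by
    refine le_antisymm (fun c hc ↦ hC.mem_span_of_mem c fun h ↦
      hc (isUnit_of_map_unit C.subtype c h)) ?_
    rw [Ideal.span_singleton_le_iff_mem, mem_maximalIdeal, mem_nonunits_iff]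
    exact fun h ↦ hC.coe_mem (h.map C.subtype)
  let S := R ⧸ Ideal.span {(ϖ : R)}
  have : Nontrivial S := Ideal.Quotient.nontrivial_iff.2 fun h ↦ hC.coe_mem (by
    simpa [Ideal.span_singleton_eq_top] using h)
  have : IsLocalRing S := of_surjective' (Ideal.Quotient.mk _) Ideal.Quotient.mk_surjective
  obtain ⟨l, N, hl, hN, hdim⟩ := exists_list_maximalIdeal_pow_le S
  obtain ⟨l, rfl⟩ := List.map_surjective_iff.2 (Ideal.Quotient.mk_surjective (I := Ideal.span {(ϖ : R)})) l
  have hlm : ∀ t ∈ l, t ∈ maximalIdeal R := fun t ht h ↦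
    hl _ (List.mem_map_of_mem ht) (h.map _)
  have hle : maximalIdeal R ^ N ≤ Ideal.span {t | t ∈ l} ⊔ Ideal.span {(ϖ : R)} := by
    have hmap : (maximalIdeal R).map (Ideal.Quotient.mk (Ideal.span {(ϖ : R)})) ≤
        maximalIdeal S := by
      refine Ideal.map_le_iff_le_comap.2 (le_of_eq (eq_maximalIdeal ?_).symm)
      exact Ideal.comap_isMaximal_of_surjective _ Ideal.Quotient.mk_surjective
    intro x hx
    have hx' := (Ideal.pow_right_mono hmap N).trans hN
      (Ideal.map_pow (Ideal.Quotient.mk (Ideal.span {(ϖ : R)})) _ N ▸ Ideal.mem_map_of_mem _ hx)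
    rw [show {t | t ∈ l.map (Ideal.Quotient.mk (Ideal.span {(ϖ : R)}))} =
      Ideal.Quotient.mk (Ideal.span {(ϖ : R)}) '' {t | t ∈ l} by ext; simp, ← Ideal.map_span,
      ← Ideal.mem_comap, Ideal.comap_map_of_surjective _ Ideal.Quotient.mk_surjective,
      ← RingHom.ker_eq_comap_bot, Ideal.mk_ker] at hx'
    exact hx'
  obtain ⟨n, e, he⟩ := exists_isGeneratedModulo_pow (φ := C.subtype) (fun r ↦ by
    obtain ⟨c, hc, h⟩ := hC.exists_sub_mem r
    exact ⟨⟨c, hc⟩, h⟩) N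
  obtain ⟨B, _, _, _, _, ψ, hψ, hBdim⟩ := exists_isGeneratedModulo_bot l hlm C C.subtype
    (.of_sup_span hC.hasGeometricSums hC.coe_mem fun r ↦ (he r).imp fun d hd ↦ hle hd)
  have hint : ψ.IsIntegral := hψ.finite.to_isIntegral
  obtain ⟨m, hm⟩ : ∃ m : ℕ, ringKrullDim R = m := by
    obtain ⟨l, N, -, -, h⟩ := exists_list_maximalIdeal_pow_le R
    exact ⟨_, h.symm⟩
  refine ⟨B, _, ‹_›, ‹_›, ‹_›, ψ, hint.injective_of_ringKrullDim_le (hBdim.trans ?_) hm, hint⟩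
  rw [List.length_map] at hdim
  rw [hdim]
  by_cases hϖ : ϖ = 0
  · have hfield : IsField C := isField_iff_maximalIdeal_eq.2 (by simp [hmax, hϖ])
    rw [ringKrullDim_eq_zero_of_isField hfield, zero_add]
    exact ringKrullDim_le_of_surjective _ Ideal.Quotient.mk_surjective
  · have hϖ' : (ϖ : R) ≠ 0 := by simpa using hϖ
    refine le_trans ?_ (ringKrullDim_quotient_succ_le_of_nonZeroDivisor
      (mem_nonZeroDivisors_of_ne_zero hϖ'))
    rw [add_comm]
    gcongr
    exact Ring.krullDimLE_iff.1 (IsPrincipalIdealRing.krullDimLE_one C)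

end

/-- Over a complete Noetherian local domain, two families which are proportional and each of which
generates an ideal of height at least two differ by a unit of the normalization. -/
lemma IsLocalRing.exists_unit_integralClosure_mul_eq {R : Type u} [CommRing R] [IsDomain R]
    [IsNoetherianRing R] [IsLocalRing R] [IsAdicComplete (IsLocalRing.maximalIdeal R) R]
    {ι : Type*} {f g : ι → R} (hfg : ∀ i j, f i * g j = f j * g i)
    (hf : ∀ P ∈ (Ideal.span (Set.range f)).minimalPrimes, 2 ≤ P.height)
    (hg : ∀ P ∈ (Ideal.span (Set.range g)).minimalPrimes, 2 ≤ P.height) :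
    ∃ u : (integralClosure R (FractionRing R))ˣ,
      ∀ i, ((u : integralClosure R (FractionRing R)) : FractionRing R) *
        algebraMap R (FractionRing R) (g i) = algebraMap R (FractionRing R) (f i) := by
  obtain ⟨A, _, _, _, _, φ, hφ, hφi⟩ := IsLocalRing.exists_isIntegral_of_isIntegrallyClosed R
  let : Algebra A R := φ.toAlgebra
  have : Algebra.IsIntegral A R := ⟨hφi⟩
  have : FaithfulSMul A R := (faithfulSMul_iff_algebraMap_injective A R).2 hφ
  have hinj := IsFractionRing.injective R (FractionRing R)
  have hne (h : ι → R) (hh : ∀ P ∈ (Ideal.span (Set.range h)).minimalPrimes, 2 ≤ P.height) :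
      ∃ i, h i ≠ 0 := by
    by_contra! hcon
    have hbot : Ideal.span (Set.range h) = ⊥ := by
      rw [Ideal.span_eq_bot]; rintro _ ⟨i, rfl⟩; exact hcon i
    have := hh ⊥ (by rw [hbot, Ideal.minimalPrimes_eq_subsingleton_self]; rfl)
    simp at this
  have key {f g : ι → R} (hfg : ∀ i j, f i * g j = f j * g i)
      (hg : ∀ P ∈ (Ideal.span (Set.range g)).minimalPrimes, 2 ≤ P.height) (i : ι) (hi : g i ≠ 0) :
      IsIntegral R (algebraMap R (FractionRing R) (f i) / algebraMap R (FractionRing R) (g i)) ∧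
      ∀ j, (algebraMap R (FractionRing R) (f i) / algebraMap R (FractionRing R) (g i)) *
        algebraMap R (FractionRing R) (g j) = algebraMap R (FractionRing R) (f j) := by
    have hi' : algebraMap R (FractionRing R) (g i) ≠ 0 := by simpa using hi
    have hmul (j : ι) : (algebraMap R (FractionRing R) (f i) /
        algebraMap R (FractionRing R) (g i)) * algebraMap R (FractionRing R) (g j) =
        algebraMap R (FractionRing R) (f j) := by
      rw [div_mul_eq_mul_div, div_eq_iff hi', ← map_mul, ← map_mul, hfg]
    refine ⟨isIntegral_of_mul_mem_range_of_two_le_height (A := A) hg fun x hx ↦ ?_, hmul⟩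
    induction hx using Submodule.span_induction with
    | mem x hx => obtain ⟨j, rfl⟩ := hx; exact ⟨f j, by rw [← hmul j, mul_comm]⟩
    | zero => exact ⟨0, by simp⟩
    | add x z _ _ hx hz => rw [map_add, add_mul]; exact add_mem hx hz
    | smul r x _ hx =>
      rw [smul_eq_mul, map_mul, mul_assoc]; exact mul_mem ⟨r, rfl⟩ hx
  obtain ⟨i, hi⟩ := hne g hg
  obtain ⟨j, hj⟩ := hne f hf
  obtain ⟨hu, hmul⟩ := key hfg hg i hi
  have hfi : f i ≠ 0 := fun h ↦ by
    have := hfg i j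
    rw [h, zero_mul, eq_comm, mul_eq_zero] at this
    exact this.elim hj hi
  obtain ⟨hv, -⟩ := key (fun i j ↦ by rw [mul_comm, ← hfg, mul_comm]) hf i hfi
  have hi' : algebraMap R (FractionRing R) (g i) ≠ 0 := by simpa using hi
  have hfi' : algebraMap R (FractionRing R) (f i) ≠ 0 := by simpa using hfi
  exact ⟨⟨⟨_, hu⟩, ⟨_, hv⟩, Subtype.ext (by simp [hi', hfi']), Subtype.ext (by simp [hi', hfi'])⟩, hmul⟩

/-- Over a complete Noetherian local domain, if the residual pseudo-representation is
reducible and every minimal prime over each of `I_α`, `I_α'` has height at least `2`,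
then `u(α, α')` is a unit in the integral closure of `R`. -/
theorem stmt_10 {R : Type*} [CommRing R] [IsDomain R] [IsNoetherianRing R]
    [IsLocalRing R] [IsAdicComplete (IsLocalRing.maximalIdeal R) R]
    [Invertible (2 : R)] {G : Type*} [Group G]
    (T : G → R) (c : G)
    (hc : c ^ 2 = 1) (hT1 : T 1 = 2) (hTc : T c = 0)
    (hcomm : ∀ σ τ : G, T (σ * τ) = T (τ * σ))
    (hrel : ∀ γ δ η : G,
      T (γ * δ * η) + T (γ * η * δ) - T (γ * η) * T δ - T (η * δ) * T γ
        - T (δ * γ) * T η + T γ * T δ * T η = 0)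
    (a d : G → R) (y : G → G → R)
    (ha : ∀ σ : G, 2 * a σ = T (c * σ) + T σ)
    (hd : ∀ σ : G, 2 * d σ = T σ - T (c * σ))
    (hy : ∀ σ τ : G, y σ τ = a (σ * τ) - a σ * a τ)
    (hred : ∀ σ τ : G, y σ τ ∈ IsLocalRing.maximalIdeal R)
    (α α' : G)
    (hht : ∀ 𝔭 ∈ (Ideal.span (Set.range (y α))).minimalPrimes, ∀ (h𝔭 : 𝔭.IsPrime),
      2 ≤ Order.height (⟨𝔭, h𝔭⟩ : PrimeSpectrum R))
    (hht' : ∀ 𝔭 ∈ (Ideal.span (Set.range (y α'))).minimalPrimes, ∀ (h𝔭 : 𝔭.IsPrime),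
      2 ≤ Order.height (⟨𝔭, h𝔭⟩ : PrimeSpectrum R)) :
    ∃ u : (integralClosure R (FractionRing R))ˣ,
      ∀ β : G, ((u : integralClosure R (FractionRing R)) : FractionRing R) *
          algebraMap R (FractionRing R) (y α' β) =
        algebraMap R (FractionRing R) (y α β) := by
  refine IsLocalRing.exists_unit_integralClosure_mul_eq (f := y α) (g := y α')
    (fun β β' ↦ ?_) (fun P hP ↦ ?_) (fun P hP ↦ ?_)
  · rw [pseudorep_y_mul_y T c hc hT1 hTc hcomm hrel a y ha hy, mul_comm]
  · rw [PrimeSpectrum.height_eq_orderHeight ⟨P, hP.1.1⟩]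
    exact hht P hP hP.1.1
  · rw [PrimeSpectrum.height_eq_orderHeight ⟨P, hP.1.1⟩]
    exact hht' P hP hP.1.1
end

section
/- Let R be an integral domain in which 2 is invertible, with fraction field K, let G be a group, and let T be a 2-dimensional pseudo-representation of G over R with respect to c ∈ G, with associated functions a, d, y. Suppose σ₀, τ₀ ∈ G satisfy y(σ₀, τ₀) ≠ 0. Define ρ : G → M₂(K) by ρ(σ) = [[a(σ), y(σ, τ₀)/y(σ₀, τ₀)], [y(σ₀, σ), d(σ)]]. Then ρ(1) is the identity matrix, ρ(στ) = ρ(σ)·ρ(τ) for all σ, τ ∈ G, tr(ρ(σ)) = T(σ) for all σ ∈ G, and det(ρ(σ)) = (1/2)(T(σ)² − T(σ²)) is invertible in K for all σ ∈ G; in particular ρ defines a group homomorphism G → GL₂(K) with trace T. -/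
/-- The polarised trace identity at an involution of trace zero. -/
theorem trace_involution_mul {R : Type*} [CommRing R] {G : Type*} [Group G]
    {T : G → R} {c : G} (hTc : T c = 0)
    (hcomm : ∀ σ τ : G, T (σ * τ) = T (τ * σ))
    (hrel : ∀ γ δ η : G,
      T (γ * δ * η) + T (γ * η * δ) - T (γ * η) * T δ - T (η * δ) * T γ
        - T (δ * γ) * T η + T γ * T δ * T η = 0) (σ τ : G) :
    T (c * (σ * τ)) + T (σ * (c * τ)) = T σ * T (c * τ) + T (c * σ) * T τ := by
  have h := hrel c σ τ
  have h₁ : T (c * (τ * σ)) = T (σ * (c * τ)) := by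
    rw [← mul_assoc, hcomm]
  rw [mul_assoc, mul_assoc, h₁, hTc, hcomm σ c] at h
  linear_combination h

theorem trace_involution_mul_involution_mul {R : Type*} [CommRing R] {G : Type*} [Group G]
    {T : G → R} {c : G} (hc : c ^ 2 = 1) (hTc : T c = 0)
    (hcomm : ∀ σ τ : G, T (σ * τ) = T (τ * σ))
    (hrel : ∀ γ δ η : G,
      T (γ * δ * η) + T (γ * η * δ) - T (γ * η) * T δ - T (η * δ) * T γ
        - T (δ * γ) * T η + T γ * T δ * T η = 0) (σ τ : G) :
    T (σ * τ) + T (c * (σ * (c * τ))) = T σ * T τ + T (c * σ) * T (c * τ) := by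
  have h := trace_involution_mul hTc hcomm hrel (c * σ) τ
  have hcc (x : G) : c * (c * x) = x := by rw [← mul_assoc, ← sq, hc, one_mul]
  rw [mul_assoc, hcc, hcc, mul_assoc] at h
  linear_combination h

/-- The product of the off-diagonal entries is `T(eσ(1 - e)τ)` for `e = (1 + c)/2`. -/
theorem four_mul_offDiag {R : Type*} [CommRing R] {G : Type*} [Group G]
    {T : G → R} {c : G} (hc : c ^ 2 = 1) (hTc : T c = 0)
    (hcomm : ∀ σ τ : G, T (σ * τ) = T (τ * σ))
    (hrel : ∀ γ δ η : G,
      T (γ * δ * η) + T (γ * η * δ) - T (γ * η) * T δ - T (η * δ) * T γ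
        - T (δ * γ) * T η + T γ * T δ * T η = 0)
    {a : G → R} {y : G → G → R}
    (ha : ∀ σ : G, 2 * a σ = T (c * σ) + T σ)
    (hy : ∀ σ τ : G, y σ τ = a (σ * τ) - a σ * a τ) (σ τ : G) :
    4 * y σ τ = T (σ * τ) + T (c * (σ * τ)) - T (σ * (c * τ)) - T (c * (σ * (c * τ))) := by
  rw [hy]
  linear_combination 2 * ha (σ * τ) - 2 * a τ * ha σ - (T (c * σ) + T σ) * ha τ
    + trace_involution_mul hTc hcomm hrel σ τ
    + trace_involution_mul_involution_mul hc hTc hcomm hrel σ τ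

theorem offDiag_mul_left {R : Type*} [CommRing R] [Invertible (2 : R)] {G : Type*} [Group G]
    {T : G → R} {c : G} (hc : c ^ 2 = 1) (hTc : T c = 0)
    (hcomm : ∀ σ τ : G, T (σ * τ) = T (τ * σ))
    (hrel : ∀ γ δ η : G,
      T (γ * δ * η) + T (γ * η * δ) - T (γ * η) * T δ - T (η * δ) * T γ
        - T (δ * γ) * T η + T γ * T δ * T η = 0)
    {a d : G → R} {y : G → G → R}
    (ha : ∀ σ : G, 2 * a σ = T (c * σ) + T σ)
    (hd : ∀ σ : G, 2 * d σ = T σ - T (c * σ))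
    (hy : ∀ σ τ : G, y σ τ = a (σ * τ) - a σ * a τ) (σ τ ρ : G) :
    y (σ * τ) ρ = a σ * y τ ρ + y σ ρ * d τ := by
  have Y := four_mul_offDiag hc hTc hcomm hrel ha hy
  have A := trace_involution_mul hTc hcomm hrel
  have B := trace_involution_mul_involution_mul hc hTc hcomm hrel
  have cyc (x z w : G) : T (x * (z * w)) = T (w * (x * z)) := by rw [← mul_assoc, hcomm]
  have cycl (x z w v : G) : T (x * (z * (w * v))) = T (v * (x * (z * w))) := by
    rw [← mul_assoc, cyc, mul_assoc]
  have y₁ := Y (σ * τ) ρ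
  have y₂ := Y τ ρ
  have y₃ := Y σ ρ
  have e₁ := A σ (τ * ρ)
  have e₂ := B σ (τ * ρ)
  have e₃ := A σ (τ * (c * ρ))
  have e₄ := B σ (τ * (c * ρ))
  have f₁ := A τ (ρ * σ)
  have f₂ := B τ (ρ * σ)
  have f₃ := A τ (ρ * (c * σ))
  have f₄ := B τ (ρ * (c * σ))
  have z₁ : T (c * (τ * (ρ * σ))) = T (σ * (c * (τ * ρ))) := cycl _ _ _ _
  have z₂ : T (τ * (c * (ρ * σ))) = T (σ * (τ * (c * ρ))) := cycl _ _ _ _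
  have z₃ : T (c * (τ * (c * (ρ * σ)))) = T (σ * (c * (τ * (c * ρ)))) := by
    simpa only [mul_assoc] using hcomm (c * τ * c * ρ) σ
  have z₄ : T (τ * (ρ * (c * σ))) = T (c * (σ * (τ * ρ))) := by
    simpa only [mul_assoc] using hcomm (τ * ρ) (c * σ)
  have z₅ : T (c * (τ * (ρ * (c * σ)))) = T (c * (σ * (c * (τ * ρ)))) := by
    simpa only [mul_assoc] using hcomm (c * τ * ρ) (c * σ)
  have z₆ : T (τ * (c * (ρ * (c * σ)))) = T (c * (σ * (τ * (c * ρ)))) := by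
    simpa only [mul_assoc] using hcomm (τ * c * ρ) (c * σ)
  have z₇ : T (c * (τ * (c * (ρ * (c * σ))))) = T (c * (σ * (c * (τ * (c * ρ))))) := by
    simpa only [mul_assoc] using hcomm (c * τ * c * ρ) (c * σ)
  have w₁ : T (c * (ρ * σ)) = T (σ * (c * ρ)) := cyc _ _ _
  have w₂ : T (ρ * (c * σ)) = T (c * (σ * ρ)) := by
    simpa only [mul_assoc] using hcomm ρ (c * σ)
  have w₃ : T (c * (ρ * (c * σ))) = T (c * (σ * (c * ρ))) := by
    simpa only [mul_assoc] using hcomm (c * ρ) (c * σ)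
  rw [z₁, z₂, w₁, hcomm ρ σ] at f₁
  rw [cyc τ ρ σ, z₃, w₁, hcomm ρ σ] at f₂
  rw [z₅, z₆, w₂, w₃] at f₃
  rw [z₄, z₇, w₂, w₃] at f₄
  simp only [mul_assoc] at y₁
  have h2 : IsUnit (2 : R) := isUnit_of_invertible 2
  have h8 : IsUnit (2 * (2 * 2) : R) := h2.mul (h2.mul h2)
  refine h8.mul_left_cancel ?_
  linear_combination 2 * y₁ - 2 * a σ * y₂ - 2 * d τ * y₃
    - (T (τ * ρ) + T (c * (τ * ρ)) - T (τ * (c * ρ)) - T (c * (τ * (c * ρ)))) * ha σ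
    - (T (σ * ρ) + T (c * (σ * ρ)) - T (σ * (c * ρ)) - T (c * (σ * (c * ρ)))) * hd τ
    + e₁ + e₂ - e₃ - e₄ + f₂ - f₁ + f₄ - f₃


/-- The representation associated to an irreducible pseudo-representation over a
domain: it is multiplicative, has trace `T`, and has invertible determinant
`(1/2)(T(σ)² − T(σ²))`; hence it gives a homomorphism `G → GL₂(K)` of trace `T`. -/
theorem stmt_13 {R : Type*} [CommRing R] [IsDomain R] [Invertible (2 : R)]
    {G : Type*} [Group G]
    (T : G → R) (c : G)
    (hc : c ^ 2 = 1) (hT1 : T 1 = 2) (hTc : T c = 0)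
    (hcomm : ∀ σ τ : G, T (σ * τ) = T (τ * σ))
    (hrel : ∀ γ δ η : G,
      T (γ * δ * η) + T (γ * η * δ) - T (γ * η) * T δ - T (η * δ) * T γ
        - T (δ * γ) * T η + T γ * T δ * T η = 0)
    (a d : G → R) (y : G → G → R)
    (ha : ∀ σ : G, 2 * a σ = T (c * σ) + T σ)
    (hd : ∀ σ : G, 2 * d σ = T σ - T (c * σ))
    (hy : ∀ σ τ : G, y σ τ = a (σ * τ) - a σ * a τ)
    (σ₀ τ₀ : G) (h0 : y σ₀ τ₀ ≠ 0) :
    let i : R →+* FractionRing R := algebraMap R (FractionRing R)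
    let ρ : G → Matrix (Fin 2) (Fin 2) (FractionRing R) := fun σ =>
      !![i (a σ), i (y σ τ₀) / i (y σ₀ τ₀); i (y σ₀ σ), i (d σ)]
    ρ 1 = 1 ∧ (∀ σ τ : G, ρ (σ * τ) = ρ σ * ρ τ) ∧
      (∀ σ : G, (ρ σ).trace = i (T σ)) ∧
      (∀ σ : G, 2 * (ρ σ).det = i (T σ ^ 2 - T (σ ^ 2)) ∧ IsUnit (ρ σ).det) := by
  intro i ρ
  have h2 : IsUnit (2 : R) := isUnit_of_invertible 2
  have had (σ : G) : a σ + d σ = T σ :=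
    h2.mul_left_cancel (by linear_combination ha σ + hd σ)
  have ha1 : a 1 = 1 := h2.mul_left_cancel (by
    rw [ha, mul_one, hTc, hT1]
    ring)
  have hd1 : d 1 = 1 := by linear_combination had 1 - ha1 + hT1
  have hL := offDiag_mul_left hc hTc hcomm hrel ha hd hy
  have hR (σ τ μ : G) : y σ (τ * μ) = y σ μ * d τ + y σ τ * a μ := by
    have h₁ := hy σ (τ * μ)
    rw [← mul_assoc] at h₁
    linear_combination h₁ - hy (σ * τ) μ + hL σ τ μ + a σ * hy τ μ - a μ * hy σ τ
  have hD (σ τ : G) : d (σ * τ) = d σ * d τ + y τ σ := by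
    have h := trace_involution_mul hTc hcomm hrel σ τ
    have h₁ : T (σ * (c * τ)) = T (c * (τ * σ)) := by rw [hcomm, mul_assoc]
    rw [h₁] at h
    refine (h2.mul h2).mul_left_cancel ?_
    linear_combination 2 * hd (σ * τ) - 2 * d τ * hd σ - (T σ - T (c * σ)) * hd τ
      - 4 * hy τ σ - 2 * ha (τ * σ) + 2 * a σ * ha τ + (T τ + T (c * τ)) * ha σ
      - 2 * h + 2 * hcomm σ τ
  have hX (σ τ μ ν : G) : y σ τ * y μ ν = y σ ν * y μ τ := by
    have h₁ := hL (σ * τ) μ ν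
    rw [mul_assoc] at h₁
    linear_combination hL σ (τ * μ) ν - h₁ + y μ ν * hy σ τ - d μ * hL σ τ ν
      + a σ * hL τ μ ν + y σ ν * hD τ μ
  have hi0 : i (y σ₀ τ₀) ≠ 0 := by
    simpa [i] using h0
  have hdiv (σ τ : G) : i (y σ τ₀) / i (y σ₀ τ₀) * i (y σ₀ τ) = i (y σ τ) := by
    rw [div_mul_eq_mul_div, div_eq_iff hi0, ← map_mul, ← map_mul, hX]
  have hone : ρ 1 = 1 := by
    have h₁ : y 1 τ₀ = 0 := by rw [hy, one_mul, ha1]; ring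
    have h₂ : y σ₀ 1 = 0 := by rw [hy, mul_one, ha1]; ring
    simp [ρ, ha1, hd1, h₁, h₂, Matrix.one_fin_two]
  have hmul (σ τ : G) : ρ (σ * τ) = ρ σ * ρ τ := by
    have h₁ : i (a (σ * τ)) = i (a σ) * i (a τ) + i (y σ τ₀) / i (y σ₀ τ₀) * i (y σ₀ τ) := by
      rw [hdiv, hy, map_sub, map_mul]
      ring
    have h₂ : i (y (σ * τ) τ₀) / i (y σ₀ τ₀) =
        i (a σ) * (i (y τ τ₀) / i (y σ₀ τ₀)) + i (y σ τ₀) / i (y σ₀ τ₀) * i (d τ) := by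
      rw [hL, map_add, map_mul, map_mul]
      ring
    have h₃ : i (y σ₀ (σ * τ)) = i (y σ₀ σ) * i (a τ) + i (d σ) * i (y σ₀ τ) := by
      rw [hR, map_add, map_mul, map_mul]
      ring
    have h₄ : i (d (σ * τ)) = i (y σ₀ σ) * (i (y τ τ₀) / i (y σ₀ τ₀)) + i (d σ) * i (d τ) := by
      rw [mul_comm (i (y σ₀ σ)), hdiv, hD, map_add, map_mul]
      ring
    simp only [ρ, Matrix.mul_fin_two, h₁, h₂, h₃, h₄]
  refine ⟨hone, hmul, fun σ => ?_, fun σ => ⟨?_, ?_⟩⟩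
  · simp [ρ, Matrix.trace_fin_two, ← had]
  · have h : 2 * (a σ * d σ - y σ σ) = T σ ^ 2 - T (σ ^ 2) := by
      rw [sq σ, ← had (σ * σ), hD, ← had σ, hy]
      ring
    rw [← h, Matrix.det_fin_two_of, hdiv, map_mul, map_sub, map_mul, map_ofNat]
  · refine .of_mul_eq_one (ρ σ⁻¹).det ?_
    rw [← Matrix.det_mul, ← hmul, mul_inv_cancel, hone, Matrix.det_one]
end
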